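/- arXiv:1510.00218 — 3 statements merged into one kernel-verified Lean document; each statement's English description precedes it below -/
import Mathlib

section
/- Let (K, D) be a model of W_e-DCF. Then for all i_1,…,i_e ∈ ℕ: D_{(i_1,…,i_e)} = D_{i_1·𝐞_1} ∘ (D_{i_2·𝐞_1})^(p) ∘ (D_{i_3·𝐞_1})^(p^2) ∘ … ∘ (D_{i_e·𝐞_1})^(p^{e−1}). -/
noncomputable section

open scoped BigOperators

/-- The `m`-th Witt addition polynomial with coefficients reduced mod `p`. -/
def wittHmod (p : ℕ) [Fact p.Prime] (m : ℕ) : MvPolynomial (Fin 2 × ℕ) (ZMod p) :=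
  MvPolynomial.map (Int.castRingHom (ZMod p)) (WittVector.wittAdd p m)

/-- The exponent (as a finitely supported function) of the monomial `X̄^i * Ȳ^j`,
where `X_{m+1}` is the variable `(0, m)` and `Y_{m+1}` is the variable `(1, m)`. -/
def xyExp (e : ℕ) (i j : Fin e → ℕ) : (Fin 2 × ℕ) →₀ ℕ :=
  ∑ m : Fin e, (Finsupp.single ((0 : Fin 2), (m : ℕ)) (i m) +
    Finsupp.single ((1 : Fin 2), (m : ℕ)) (j m))

/-- `wittAlpha p e i j l` is the coefficient `α_{i,j}(l) ∈ 𝔽_p` of the monomial `X̄^i * Ȳ^j` in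
`H_1^{l_1} ⋯ H_e^{l_e}`, where `H_1, …, H_e` are the polynomials giving the group law of the
`e`-dimensional Witt group over `𝔽_p`. -/
def wittAlpha (p : ℕ) [Fact p.Prime] (e : ℕ) (i j l : Fin e → ℕ) : ZMod p :=
  MvPolynomial.coeff (xyExp e i j) (∏ m : Fin e, (wittHmod p (m : ℕ)) ^ (l m))

/-- `(K, D)` is a model of `W_e`-DCF:  `K` is a separably closed field of characteristic `p` with
`[K : K^p] = p^e` (where `K^p` is the subfield of `p`-th powers, i.e. the range of the Frobenius)
and `D` is a strict `W_e`-iterative Hasse–Schmidt derivation of dimension `e`.  Multi-indices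
`𝐢 ∈ ℕ^e` are represented as functions `Fin e → ℕ`, and the scalars `α_{𝐢,𝐣}(𝐥) ∈ 𝔽_p` act on `K`
via `ZMod.cast` (the iterated sum of `1`). -/
def IsWeDCF (p e : ℕ) [Fact p.Prime] (K : Type*) [Field K] [CharP K p]
    (D : (Fin e → ℕ) → K → K) : Prop :=
  IsSepClosed K ∧
  Module.finrank ↥(RingHom.fieldRange (frobenius K p)) K = p ^ e ∧
  D 0 = id ∧
  (∀ i : Fin e → ℕ, ∀ x y : K, D i (x + y) = D i x + D i y) ∧
  (∀ i : Fin e → ℕ, ∀ x y : K, D i (x * y) =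
     ∑ k ∈ Finset.Iic i, D k x * D (i - k) y) ∧
  (∀ i j : Fin e → ℕ, ∀ x : K,
     D i (D j x) = ∑ᶠ l : Fin e → ℕ, ZMod.cast (wittAlpha p e i j l) * D l x) ∧
  (∀ x : K, (∀ m : Fin e, D (Pi.single m 1) x = 0) ↔ ∃ y : K, x = y ^ p)

/-- `hsComp p e D v` is the composition
`D_{v_1} ∘ (D_{v_2})^(p) ∘ (D_{v_3})^(p^2) ∘ … ∘ (D_{v_e})^(p^{e-1})`
of iterates of the one-variable operators `D_n : K → K`. -/
def hsComp {K : Type*} (p e : ℕ) (D : ℕ → K → K) (v : Fin e → ℕ) : K → K :=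
  (List.ofFn fun m : Fin e => (D (v m))^[p ^ (m : ℕ)]).foldr (· ∘ ·) id

open MvPolynomial

section WittCoefficients

variable {p : ℕ} [Fact p.Prime] {e : ℕ}

theorem xyExp_apply_zero (i j : Fin e → ℕ) (m : Fin e) : xyExp e i j (0, (m : ℕ)) = i m := by
  classical
  simp [xyExp, Finsupp.finsetSum_apply, Finsupp.single_apply, Fin.val_inj]

theorem xyExp_apply_one (i j : Fin e → ℕ) (m : Fin e) : xyExp e i j (1, (m : ℕ)) = j m := by
  classical
  simp [xyExp, Finsupp.finsetSum_apply, Finsupp.single_apply, Fin.val_inj]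

theorem xyExp_apply_of_le (i j : Fin e → ℕ) (b : Fin 2) {m : ℕ} (hm : e ≤ m) :
    xyExp e i j (b, m) = 0 := by
  classical
  simp only [xyExp, Finsupp.finsetSum_apply, Finsupp.add_apply, Finsupp.single_apply]
  refine Finset.sum_eq_zero fun k _ => ?_
  have : (k : ℕ) ≠ m := by omega
  simp [this]

theorem xyExp_injective : Function.Injective fun x : (Fin e → ℕ) × (Fin e → ℕ) => xyExp e x.1 x.2 := by
  rintro ⟨i, j⟩ ⟨i', j'⟩ h
  simp only at h
  ext m
  · simpa [xyExp_apply_zero] using DFunLike.congr_fun h (0, (m : ℕ))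
  · simpa [xyExp_apply_one] using DFunLike.congr_fun h (1, (m : ℕ))

theorem exists_eq_xyExp {s : Fin 2 × ℕ →₀ ℕ} (hs : ∀ b m, e ≤ m → s (b, m) = 0) :
    ∃ i j : Fin e → ℕ, s = xyExp e i j := by
  refine ⟨fun m => s (0, m), fun m => s (1, m), ?_⟩
  ext ⟨b, m⟩
  rcases lt_or_ge m e with hm | hm
  · fin_cases b
    · exact (xyExp_apply_zero (fun k => s (0, (k : ℕ))) _ ⟨m, hm⟩).symm
    · exact (xyExp_apply_one _ (fun k => s (1, (k : ℕ))) ⟨m, hm⟩).symm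
  · rw [hs b m hm, xyExp_apply_of_le _ _ _ hm]

theorem prod_xyExp {R : Type*} [CommRing R] (g : Fin 2 × ℕ → R) (i j : Fin e → ℕ) :
    ((xyExp e i j).prod fun x n => g x ^ n) =
      (∏ m : Fin e, g (0, m) ^ i m) * ∏ m : Fin e, g (1, m) ^ j m := by
  classical
  rw [xyExp, ← Finsupp.prod_finsetSum_index (by simp) (by simp [pow_add]), ← Finset.prod_mul_distrib]
  refine Finset.prod_congr rfl fun m _ => ?_
  rw [Finsupp.prod_add_index' (by simp) (by simp [pow_add])]
  simp

/-- The product `∏ H_m ^ l_m` of powers of Witt addition polynomials. -/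
def wittAddMonomial (p : ℕ) [Fact p.Prime] (e : ℕ) (l : Fin e → ℕ) :
    MvPolynomial (Fin 2 × ℕ) (ZMod p) :=
  ∏ m : Fin e, wittHmod p (m : ℕ) ^ l m

theorem exists_eq_xyExp_of_mem_support {l : Fin e → ℕ} {s : Fin 2 × ℕ →₀ ℕ}
    (hs : s ∈ (wittAddMonomial p e l).support) : ∃ i j : Fin e → ℕ, s = xyExp e i j := by
  refine exists_eq_xyExp fun b m hm => mem_support_notMem_vars_zero hs fun hmem => ?_
  have hsup : wittAddMonomial p e l ∈ supported (ZMod p) {x : Fin 2 × ℕ | x.2 < e} := by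
    refine prod_mem fun k _ => pow_mem (mem_supported.2 fun x hx => ?_) _
    have := WittVector.wittAdd_vars p (k : ℕ) (vars_map _ _ hx)
    simp only [Finset.mem_product, Finset.mem_range] at this
    have := k.2
    simp only [Set.mem_ofPred_eq]
    omega
  have : m < e := mem_supported.1 hsup hmem
  omega

theorem aeval_wittAddMonomial {R : Type*} [CommRing R] [Algebra (ZMod p) R] (u v : WittVector p R)
    (l : Fin e → ℕ) :
    aeval (Function.uncurry ![u.coeff, v.coeff]) (wittAddMonomial p e l) =
      ∏ m : Fin e, (u + v).coeff m ^ l m := by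
  simp only [wittAddMonomial, map_prod, map_pow]
  refine Finset.prod_congr rfl fun m _ => ?_
  rw [WittVector.add_coeff, WittVector.peval, wittHmod, aeval_def, aeval_def, eval₂_map]
  congr 2
  exact RingHom.ext_int _ _

theorem sum_le_degree_of_coeff_ne_zero {l : Fin e → ℕ} {s : Fin 2 × ℕ →₀ ℕ}
    (hs : coeff s (wittAddMonomial p e l) ≠ 0) : ∑ m, l m ≤ s.degree := by
  have hmem : wittAddMonomial p e l ∈ idealOfVars (Fin 2 × ℕ) (ZMod p) ^ ∑ m, l m := by
    rw [← Finset.prod_pow_eq_pow_sum]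
    refine Ideal.prod_mem_prod fun m _ => Ideal.pow_mem_pow ?_ _
    have h0 : constantCoeff (wittHmod p (m : ℕ)) = 0 := by
      rw [wittHmod, constantCoeff_map, WittVector.constantCoeff_wittAdd, map_zero]
    rw [← pow_one (idealOfVars _ _), mem_pow_idealOfVars_iff']
    intro x hx
    have : x = 0 := by
      rw [← Finsupp.degree_eq_zero_iff]; omega
    rw [this, ← constantCoeff_eq, h0]
  by_contra! h
  exact hs ((mem_pow_idealOfVars_iff' _ _).1 hmem s h)

theorem finite_support_wittAlpha (i j : Fin e → ℕ) :
    (Function.support (wittAlpha p e i j)).Finite := by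
  refine (Set.finite_Iic fun _ : Fin e => (xyExp e i j).degree).subset fun l hl m => ?_
  exact (Finset.single_le_sum (f := l) (fun _ _ => Nat.zero_le _) (Finset.mem_univ m)).trans
    (sum_le_degree_of_coeff_ne_zero hl)

/-- The family `l ↦ α_{i,j}(l)` as a finitely supported function. -/
def wittAlphaFinsupp (p : ℕ) [Fact p.Prime] (e : ℕ) (i j : Fin e → ℕ) :
    (Fin e → ℕ) →₀ ZMod p :=
  Finsupp.ofSupportFinite (wittAlpha p e i j) (finite_support_wittAlpha i j)

end WittCoefficients

section Action

variable {p : ℕ} [Fact p.Prime] {e : ℕ} {K : Type*} [AddCommGroup K] [Module (ZMod p) K]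

/-- `F` is the operator `∑ l, ν (∏ u_m ^ l_m) • D l`, a sum with finite support. -/
def IsWittOperator {R : Type*} [CommRing R] [Algebra (ZMod p) R]
    (D : (Fin e → ℕ) → Module.End (ZMod p) K) (u : WittVector p R) (ν : R →ₗ[ZMod p] ZMod p)
    (F : Module.End (ZMod p) K) : Prop :=
  ∃ c : (Fin e → ℕ) →₀ ZMod p, (∀ l, c l = ν (∏ m : Fin e, u.coeff m ^ l m)) ∧
    Finsupp.linearCombination (ZMod p) D c = F

theorem IsWittOperator.eq_of_single {R : Type*} [CommRing R] [Algebra (ZMod p) R]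
    {D : (Fin e → ℕ) → Module.End (ZMod p) K} {u : WittVector p R} {ν : R →ₗ[ZMod p] ZMod p}
    {F : Module.End (ZMod p) K} (h : IsWittOperator D u ν F) {i : Fin e → ℕ}
    (hi : ∀ l, ν (∏ m : Fin e, u.coeff m ^ l m) = if l = i then 1 else 0) : F = D i := by
  classical
  obtain ⟨c, hc, rfl⟩ := h
  have : c = Finsupp.single i 1 := by
    ext l
    rw [hc, hi, Finsupp.single_apply]
    simp [eq_comm]
  simp [this]

theorem isWittOperator_of_single {R : Type*} [CommRing R] [Algebra (ZMod p) R]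
    (D : (Fin e → ℕ) → Module.End (ZMod p) K) {u : WittVector p R} {ν : R →ₗ[ZMod p] ZMod p}
    {i : Fin e → ℕ}
    (hi : ∀ l, ν (∏ m : Fin e, u.coeff m ^ l m) = if l = i then 1 else 0) :
    IsWittOperator D u ν (D i) := by
  classical
  refine ⟨Finsupp.single i 1, fun l => ?_, by simp⟩
  rw [hi, Finsupp.single_apply]
  simp [eq_comm]

theorem IsWittOperator.mul {R : Type*} [CommRing R] [Algebra (ZMod p) R]
    {D : (Fin e → ℕ) → Module.End (ZMod p) K}
    (hD : ∀ i j, D i * D j = Finsupp.linearCombination (ZMod p) D (wittAlphaFinsupp p e i j))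
    {u v : WittVector p R} {μ ξ ν : R →ₗ[ZMod p] ZMod p} {F G : Module.End (ZMod p) K}
    (hF : IsWittOperator D u μ F) (hG : IsWittOperator D v ξ G)
    (hν : ∀ i j : Fin e → ℕ, ν ((∏ m : Fin e, u.coeff m ^ i m) * ∏ m : Fin e, v.coeff m ^ j m) =
      μ (∏ m : Fin e, u.coeff m ^ i m) * ξ (∏ m : Fin e, v.coeff m ^ j m)) :
    IsWittOperator D (u + v) ν (F * G) := by
  classical
  obtain ⟨c, hc, rfl⟩ := hF
  obtain ⟨d, hd, rfl⟩ := hG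
  refine ⟨∑ x ∈ c.support ×ˢ d.support, (c x.1 * d x.2) • wittAlphaFinsupp p e x.1 x.2,
    fun l => ?_, ?_⟩
  · set g := Function.uncurry ![u.coeff, v.coeff] with hg
    have hgν : ∀ i j, ν ((xyExp e i j).prod fun x n => g x ^ n) = c i * d j := by
      intro i j
      rw [prod_xyExp, hc, hd, ← hν]
      simp [hg]
    let f : (Fin 2 × ℕ →₀ ℕ) → ZMod p := fun s =>
      coeff s (wittAddMonomial p e l) * ν (s.prod fun x n => g x ^ n)
    have h1 : ν (∏ m : Fin e, (u + v).coeff m ^ l m) =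
        ∑ s ∈ (wittAddMonomial p e l).support, f s := by
      rw [← aeval_wittAddMonomial, aeval_def, eval₂_eq, map_sum]
      refine Finset.sum_congr rfl fun s _ => ?_
      rw [← Algebra.smul_def, map_smul, smul_eq_mul]
      rfl
    have h2 : (∑ x ∈ c.support ×ˢ d.support,
        (c x.1 * d x.2) • wittAlphaFinsupp p e x.1 x.2) l =
        ∑ s ∈ (c.support ×ˢ d.support).image (fun x => xyExp e x.1 x.2), f s := by
      rw [Finset.sum_image xyExp_injective.injOn, Finsupp.finsetSum_apply]
      refine Finset.sum_congr rfl fun x _ => ?_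
      simp only [f, hgν]
      exact mul_comm _ _
    rw [h1, h2, ← finsum_eq_sum_of_support_subset, ← finsum_eq_sum_of_support_subset]
    · intro s hs
      exact mem_support_iff.2 (left_ne_zero_of_mul hs)
    · intro s hs
      obtain ⟨i, j, rfl⟩ := exists_eq_xyExp_of_mem_support
        (mem_support_iff.2 (left_ne_zero_of_mul hs))
      have := right_ne_zero_of_mul hs
      rw [hgν] at this
      simp only [Finset.coe_image, Finset.coe_product, Set.mem_image]
      exact ⟨(i, j), by simpa using mul_ne_zero_iff.1 this, rfl⟩
  · simp only [map_sum, map_smul, ← hD, Finsupp.linearCombination_apply, Finsupp.sum,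
      Finset.sum_mul_sum, Finset.sum_product, smul_mul_smul_comm]

end Action

section Rotation

theorem sum_eq_sum_fixed_of_pow_eq_one {p : ℕ} [Fact p.Prime] {α : Type*} [DecidableEq α]
    (g : α → α) (hg : g^[p] = id) (S : Finset α) (hS : ∀ x ∈ S, g x ∈ S) (c : α → ZMod p)
    (hc : ∀ x, c (g x) = c x) : ∑ x ∈ S, c x = ∑ x ∈ S with g x = x, c x := by
  rw [← Finset.sum_fiberwise S c, ← Finset.sum_fiberwise (S.filter fun x => g x = x) c]
  refine Finset.sum_congr rfl fun a _ => ?_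
  rw [Finset.sum_congr rfl (fun x hx => (Finset.mem_filter.1 hx).2),
    Finset.sum_congr (s₁ := {x ∈ {x ∈ S | g x = x} | c x = a}) rfl
      (fun x hx => (Finset.mem_filter.1 hx).2), Finset.sum_const, Finset.sum_const,
    nsmul_eq_mul, nsmul_eq_mul]
  congr 1
  let T := {x ∈ S | c x = a}
  have hT : ∀ x ∈ T, g x ∈ T := fun x hx => by
    simp only [T, Finset.mem_filter] at hx ⊢
    exact ⟨hS x hx.1, (hc x).trans hx.2⟩
  let f : Function.End T := fun x => ⟨g x, hT x x.2⟩
  have hf : ∀ n : ℕ, ∀ x : T, ((f ^ n) x : α) = g^[n] x := by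
    intro n
    induction n with
    | zero => intro x; rfl
    | succ n ih =>
      intro x
      rw [pow_succ, Function.iterate_succ_apply]
      exact ih (f x)
  have key := Equiv.Perm.card_fixedPoints_modEq (f := f) (p := p) (n := 1) (by
    rw [pow_one]
    funext x
    apply Subtype.ext
    rw [hf, hg]
    rfl)
  have key' := (ZMod.natCast_eq_natCast_iff _ _ _).2 key
  rw [Fintype.card_coe] at key'
  rw [key']
  congr 1
  rw [← Fintype.card_coe]
  refine Fintype.card_congr ⟨fun x => ⟨x.1.1, ?_⟩, fun x => ⟨⟨x.1, ?_⟩, ?_⟩, fun _ => rfl, fun _ => rfl⟩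
  · have h1 := x.1.2
    have h2 : g x.1.1 = x.1.1 := congrArg Subtype.val x.2
    simp only [T, Finset.mem_filter] at h1 ⊢
    exact ⟨⟨h1.1, h2⟩, h1.2⟩
  · have h1 := x.2
    simp only [T, Finset.mem_filter] at h1 ⊢
    exact ⟨h1.1.1, h1.2⟩
  · have h1 := x.2
    simp only [Finset.mem_filter] at h1
    exact Subtype.ext h1.1.2

theorem coeff_aeval_const_X {R σ : Type*} [CommRing R] (f : MvPolynomial σ R) (N : ℕ) :
    (aeval (fun _ => (Polynomial.X : Polynomial R)) f).coeff N =
      ∑ s ∈ f.support, if s.degree = N then coeff s f else 0 := by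
  rw [aeval_def, eval₂_eq, Polynomial.finsetSum_coeff]
  refine Finset.sum_congr rfl fun s _ => ?_
  rw [Finset.prod_pow_eq_pow_sum, ← Polynomial.C_eq_algebraMap, Polynomial.coeff_C_mul,
    Polynomial.coeff_X_pow, ← Finsupp.degree_apply]
  simp [eq_comm]

theorem coeff_const_eq_of_rename_eq {p : ℕ} [Fact p.Prime]
    {f : MvPolynomial (ZMod p) (ZMod p)} (hf : rename (· + 1) f = f) (n : ℕ) :
    coeff (∑ k : ZMod p, Finsupp.single k n) f =
      (aeval (fun _ => (Polynomial.X : Polynomial (ZMod p))) f).coeff (p * n) := by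
  classical
  let g : (ZMod p →₀ ℕ) → (ZMod p →₀ ℕ) := Finsupp.mapDomain (· + 1)
  have hinj : Function.Injective (· + 1 : ZMod p → ZMod p) := add_left_injective 1
  have hgc : ∀ s, coeff (g s) f = coeff s f := fun s => by
    conv_lhs => rw [← hf]
    exact coeff_rename_mapDomain _ hinj f s
  have hgn : ∀ (n : ℕ) s, g^[n] s = s.mapDomain (· + (n : ZMod p)) := by
    intro n s
    induction n with
    | zero => simp [show (fun x : ZMod p => x) = id from rfl, Finsupp.mapDomain_id]
    | succ n ih =>
      rw [Function.iterate_succ_apply', ih]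
      simp only [g]
      rw [← Finsupp.mapDomain_comp]
      congr 1
      funext x
      simp [add_assoc]
  have hgp : g^[p] = id := by
    funext s
    rw [hgn]
    simp [show (fun x : ZMod p => x) = id from rfl, Finsupp.mapDomain_id]
  have hconst : ∀ r : ℕ, ∀ k, (∑ k : ZMod p, Finsupp.single k r) k = r := fun r k => by
    simp [Finsupp.finsetSum_apply, Finsupp.single_apply]
  have hfix : ∀ s, g s = s ↔ s = ∑ k : ZMod p, Finsupp.single k (s 0) := by
    intro s
    constructor
    · intro h
      have h1 : ∀ n : ℕ, s (n : ZMod p) = s 0 := by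
        intro n
        induction n with
        | zero => simp
        | succ n ih =>
          rw [← ih]
          conv_lhs => rw [← h]
          rw [Nat.cast_succ]
          exact Finsupp.mapDomain_apply hinj s _
      ext k
      rw [hconst, ← h1 k.val, ZMod.natCast_zmod_val]
    · intro h
      ext k
      have h1 : g s ((k - 1) + 1) = s (k - 1) := Finsupp.mapDomain_apply hinj s _
      rw [sub_add_cancel] at h1
      rw [h1, h, hconst, hconst]
  have hdeg : ∀ r, (∑ k : ZMod p, Finsupp.single k r).degree = p * r := fun r => by
    simp [map_sum, ZMod.card]
  rw [coeff_aeval_const_X, sum_eq_sum_fixed_of_pow_eq_one g hgp]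
  · rw [Finset.sum_eq_single (∑ k : ZMod p, Finsupp.single k n), if_pos (hdeg n)]
    · intro s hs hne
      rw [Finset.mem_filter, hfix] at hs
      rw [if_neg]
      intro h
      rw [hs.2, hdeg] at h
      rw [Nat.eq_of_mul_eq_mul_left (Fact.out : p.Prime).pos h] at hs
      exact hne hs.2
    · intro hs
      have : coeff (∑ k : ZMod p, Finsupp.single k n) f = 0 := by
        by_contra h
        refine hs (Finset.mem_filter.2 ⟨mem_support_iff.2 h, (hfix _).2 ?_⟩)
        rw [hconst]
      rw [this, ite_self]
  · intro s hs
    rw [mem_support_iff] at hs ⊢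
    rwa [hgc]
  · intro s
    rw [hgc]
    have : (g s).degree = s.degree := by
      simp only [g, Finsupp.degree_mapDomain]
    rw [this]

end Rotation

section SingleCoefficient

variable {p e : ℕ}

variable (p) in
/-- The Witt vector with `m`-th coefficient `t` and all the others zero. -/
def wittSingle {R : Type*} [CommRing R] (m : ℕ) (t : R) : WittVector p R :=
  WittVector.mk p fun k => if k = m then t else 0

theorem wittSingle_coeff {R : Type*} [CommRing R] (m k : ℕ) (t : R) :
    (wittSingle p m t).coeff k = if k = m then t else 0 :=
  rfl

theorem prod_single_pow {R : Type*} [CommRing R] (m : Fin e) (t : R) (l : Fin e → ℕ) :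
    ∏ k : Fin e, (if k = m then t else 0) ^ l k =
      if l = Pi.single m (l m) then t ^ l m else 0 := by
  split_ifs with h
  · rw [Finset.prod_eq_single m]
    · simp
    · intro k _ hk
      rw [h]
      simp [hk]
    · simp
  · have : ∃ k, k ≠ m ∧ l k ≠ 0 := by
      by_contra! hc
      refine h (funext fun k => ?_)
      by_cases hk : k = m
      · subst hk; simp
      · simp [hk, hc k hk]
    obtain ⟨k, hk, hl⟩ := this
    exact Finset.prod_eq_zero (Finset.mem_univ k) (by rw [if_neg hk, zero_pow hl])

theorem prod_wittSingle {R : Type*} [CommRing R] (m : Fin e) (t : R) (l : Fin e → ℕ) :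
    ∏ k : Fin e, (wittSingle p m t).coeff k ^ l k =
      if l = Pi.single m (l m) then t ^ l m else 0 := by
  rw [← prod_single_pow]
  simp [wittSingle_coeff, Fin.val_inj]

end SingleCoefficient

section HyperalgebraIdentities

variable {p : ℕ} [Fact p.Prime] {e : ℕ}

theorem coeff_prod_ite_X (S : Fin e → Prop) [DecidablePred S] (l : Fin e → ℕ) :
    ∏ m, (if S m then (X m : MvPolynomial (Fin e) (ZMod p)) else 0) ^ l m =
      if ∀ m, l m ≠ 0 → S m then monomial (Finsupp.equivFunOnFinite.symm l) 1 else 0 := by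
  split_ifs with h
  · rw [monomial_eq, Finsupp.prod_fintype _ _ (by simp)]
    simp only [C_1, one_mul, Finsupp.equivFunOnFinite_symm_apply_apply]
    refine Finset.prod_congr rfl fun m _ => ?_
    by_cases hm : l m = 0
    · simp [hm]
    · rw [if_pos (h m hm)]
  · push Not at h
    obtain ⟨m, hm, hS⟩ := h
    exact Finset.prod_eq_zero (Finset.mem_univ m) (by rw [if_neg hS, zero_pow hm])

variable (p) in
/-- The generic Witt vector with coefficients outside `S` replaced by zero. -/
def genericOn (S : Fin e → Prop) [DecidablePred S] : WittVector p (MvPolynomial (Fin e) (ZMod p)) :=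
  WittVector.mk p fun k => if h : k < e then if S ⟨k, h⟩ then X ⟨k, h⟩ else 0 else 0

theorem genericOn_coeff (S : Fin e → Prop) [DecidablePred S] (m : Fin e) :
    (genericOn p S).coeff m = if S m then X m else 0 := by
  simp [genericOn]

theorem prod_genericOn (S : Fin e → Prop) [DecidablePred S] (l : Fin e → ℕ) :
    ∏ m : Fin e, (genericOn p S).coeff m ^ l m =
      if ∀ m, l m ≠ 0 → S m then monomial (Finsupp.equivFunOnFinite.symm l) 1 else 0 := by
  simp only [genericOn_coeff, coeff_prod_ite_X]

theorem lcoeff_prod_genericOn (S : Fin e → Prop) [DecidablePred S] {i : Fin e → ℕ}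
    (hi : ∀ m, i m ≠ 0 → S m) (l : Fin e → ℕ) :
    lcoeff (ZMod p) (Finsupp.equivFunOnFinite.symm i)
      (∏ m : Fin e, (genericOn p S).coeff m ^ l m) = if l = i then 1 else 0 := by
  classical
  rw [prod_genericOn, lcoeff_apply]
  by_cases hl : l = i
  · subst hl
    rw [if_pos hi, if_pos rfl, coeff_monomial, if_pos rfl]
  · rw [if_neg hl]
    split_ifs
    · rw [coeff_monomial, if_neg]
      simpa using hl
    · simp

theorem genericOn_add_compl (S : Fin e → Prop) [DecidablePred S] (m : Fin e) :
    (genericOn p S + genericOn p (fun m => ¬ S m)).coeff m = X m := by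
  rw [WittVector.coeff_add_of_disjoint, genericOn_coeff, genericOn_coeff]
  · by_cases h : S m <;> simp [h]
  · intro n
    by_cases hn : n < e
    · by_cases h : S ⟨n, hn⟩ <;> simp [genericOn, hn, h]
    · simp [genericOn, hn]

variable {K : Type*} [AddCommGroup K] [Module (ZMod p) K]
  {D : (Fin e → ℕ) → Module.End (ZMod p) K}

theorem mul_eq_add_of_disjoint
    (hD : ∀ i j, D i * D j = Finsupp.linearCombination (ZMod p) D (wittAlphaFinsupp p e i j))
    {i j : Fin e → ℕ} (hij : ∀ m, i m = 0 ∨ j m = 0) : D i * D j = D (i + j) := by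
  classical
  let S : Fin e → Prop := fun m => i m ≠ 0
  have hj : ∀ m, j m ≠ 0 → ¬ S m := fun m hm => not_not.2 ((hij m).resolve_right hm)
  have hF := isWittOperator_of_single D (lcoeff_prod_genericOn (p := p) S (i := i) fun m h => h)
  have hG := isWittOperator_of_single D (lcoeff_prod_genericOn (p := p) (fun m => ¬ S m) hj)
  refine (IsWittOperator.mul hD hF hG
    (ν := lcoeff (ZMod p) (Finsupp.equivFunOnFinite.symm (i + j))) fun k l => ?_).eq_of_single
    fun l => ?_
  · rw [lcoeff_prod_genericOn _ (fun m h => h), lcoeff_prod_genericOn _ hj, prod_genericOn,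
      prod_genericOn]
    by_cases h1 : ∀ m, k m ≠ 0 → S m
    · by_cases h2 : ∀ m, l m ≠ 0 → ¬ S m
      · rw [if_pos h1, if_pos h2, monomial_mul, mul_one, lcoeff_apply, coeff_monomial]
        have : Finsupp.equivFunOnFinite.symm k + Finsupp.equivFunOnFinite.symm l =
            Finsupp.equivFunOnFinite.symm (i + j) ↔ k = i ∧ l = j := by
          constructor
          · intro h
            have h' : ∀ m, k m + l m = i m + j m := fun m => DFunLike.congr_fun h m
            constructor <;> funext m <;> have a1 := h' m <;> have a2 := h1 m <;>
              have a3 := h2 m <;> have a4 := hij m <;> simp only [S] at a2 a3 <;> omega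
          · rintro ⟨rfl, rfl⟩
            ext m
            simp
        simp only [this, ite_and, ite_mul, one_mul, zero_mul]
      · have : l ≠ j := fun h => h2 (h ▸ hj)
        rw [if_neg h2]
        simp [this]
    · have : k ≠ i := fun h => h1 (h ▸ fun m hm => hm)
      rw [if_neg h1]
      simp [this]
  · have : ∀ m : Fin e, (genericOn p S + genericOn p (fun m => ¬ S m)).coeff m =
        (genericOn p (fun _ : Fin e => True)).coeff m := fun m => by
      rw [genericOn_add_compl, genericOn_coeff, if_pos trivial]
    simp only [this]
    exact lcoeff_prod_genericOn _ (fun _ _ => trivial) l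

theorem map_wittSingle {R S : Type*} [CommRing R] [CommRing S] (f : R →+* S) (m : ℕ) (t : R) :
    WittVector.map f (wittSingle p m t) = wittSingle p m (f t) := by
  ext k
  simp only [WittVector.map_coeff, wittSingle_coeff]
  split_ifs <;> simp

theorem coeff_single_add_X_pow_mul {σ R : Type*} [CommRing R] {S : Set σ} {a : σ} (ha : a ∉ S)
    {q : MvPolynomial σ R} (hq : q ∈ supported R S) {s : σ →₀ ℕ} (hs : s a = 0) (n r : ℕ) :
    coeff (Finsupp.single a n + s) (X a ^ r * q) =
      coeff (Finsupp.single a n) (X a ^ r : MvPolynomial σ R) * coeff s q := by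
  classical
  rw [X_pow_eq_monomial, coeff_monomial_mul', coeff_monomial, one_mul]
  rcases lt_trichotomy r n with h | rfl | h
  · have hne : Finsupp.single a r ≠ Finsupp.single a n := fun h' =>
      h.ne (Finsupp.single_injective a h')
    rw [if_neg hne, zero_mul]
    split_ifs
    · by_contra h0
      have h1 := mem_support_notMem_vars_zero (mem_support_iff.2 h0)
        (v := a) (fun hv => ha (mem_supported.1 hq hv))
      simp [hs] at h1
      omega
    · rfl
  · simp
  · have hne : Finsupp.single a r ≠ Finsupp.single a n := fun h' =>
      h.ne' (Finsupp.single_injective a h')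
    have hle : ¬ Finsupp.single a r ≤ Finsupp.single a n + s := fun h' => by
      have := h' a
      simp [hs] at this
      omega
    rw [if_neg hne, zero_mul, if_neg hle]

theorem sum_wittSingle_coeff_mem {σ : Type*} (S : Finset σ) (m k : ℕ) :
    (∑ a ∈ S, wittSingle p m (X a : MvPolynomial σ (ZMod p))).coeff k ∈
      supported (ZMod p) (S : Set σ) := by
  let ι : supported (ZMod p) (S : Set σ) →+* MvPolynomial σ (ZMod p) :=
    (supported (ZMod p) (S : Set σ)).val.toRingHom
  have : (∑ a ∈ S, wittSingle p m (X a : MvPolynomial σ (ZMod p))) =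
      WittVector.map ι (∑ a ∈ S.attach, wittSingle p m
        (⟨X a.1, X_mem_supported.2 a.2⟩ : supported (ZMod p) (S : Set σ))) := by
    rw [map_sum, ← Finset.sum_attach]
    simp only [map_wittSingle]
    rfl
  rw [this, WittVector.map_coeff]
  exact Subtype.property _

theorem isWittOperator_pow_card
    (hD : ∀ i j, D i * D j = Finsupp.linearCombination (ZMod p) D (wittAlphaFinsupp p e i j))
    (hD0 : D 0 = 1) {σ : Type*} (m : Fin e) (n : ℕ) (S : Finset σ) :
    IsWittOperator D (∑ a ∈ S, wittSingle p m (X a : MvPolynomial σ (ZMod p)))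
      (lcoeff (ZMod p) (∑ a ∈ S, Finsupp.single a n)) (D (Pi.single m n) ^ S.card) := by
  classical
  induction S using Finset.induction_on with
  | empty =>
    rw [Finset.card_empty, pow_zero, ← hD0]
    refine isWittOperator_of_single D fun l => ?_
    simp only [Finset.sum_empty, WittVector.zero_coeff, lcoeff_apply]
    split_ifs with h
    · simp [h]
    · obtain ⟨k, hk⟩ := Function.ne_iff.1 h
      rw [Finset.prod_eq_zero (Finset.mem_univ k) (zero_pow hk), coeff_zero]
  | insert a S ha ih =>
    rw [Finset.card_insert_of_notMem ha, pow_succ', Finset.sum_insert ha, Finset.sum_insert ha]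
    have h1 : IsWittOperator D (wittSingle p m (X a : MvPolynomial σ (ZMod p)))
        (lcoeff (ZMod p) (Finsupp.single a n)) (D (Pi.single m n)) := by
      refine isWittOperator_of_single D fun l => ?_
      rw [prod_wittSingle, lcoeff_apply]
      by_cases hl : l = Pi.single m n
      · subst hl
        simp [X_pow_eq_monomial]
      · rw [if_neg hl]
        split_ifs with h
        · rw [X_pow_eq_monomial, coeff_monomial, if_neg]
          intro h'
          exact hl (h.trans (by rw [Finsupp.single_injective a h']))
        · simp
    refine IsWittOperator.mul hD h1 ih fun i j => ?_
    rw [prod_wittSingle]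
    simp only [lcoeff_apply]
    have hq : ∏ k : Fin e, (∑ a ∈ S, wittSingle p m (X a : MvPolynomial σ (ZMod p))).coeff k ^ j k ∈
        supported (ZMod p) (S : Set σ) :=
      Subalgebra.prod_mem _ fun k _ => Subalgebra.pow_mem _ (sum_wittSingle_coeff_mem S m k) _
    split_ifs
    · refine coeff_single_add_X_pow_mul (S := (S : Set σ)) (by simpa using ha) hq ?_ n _
      rw [Finsupp.finsetSum_apply]
      exact Finset.sum_eq_zero fun b hb =>
        Finsupp.single_eq_of_ne (by rintro rfl; exact ha hb)
    · simp

theorem pow_char_single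
    (hD : ∀ i j, D i * D j = Finsupp.linearCombination (ZMod p) D (wittAlphaFinsupp p e i j))
    (hD0 : D 0 = 1) {m m' : Fin e} (hm : (m' : ℕ) = m + 1) (n : ℕ) :
    D (Pi.single m n) ^ p = D (Pi.single m' n) := by
  classical
  have h := isWittOperator_pow_card hD hD0 m n (Finset.univ : Finset (ZMod p))
  rw [Finset.card_univ, ZMod.card] at h
  refine h.eq_of_single fun l => ?_
  set U := ∑ a : ZMod p, wittSingle p m (X a : MvPolynomial (ZMod p) (ZMod p)) with hU
  have hrot : WittVector.map (rename (R := ZMod p) (· + 1 : ZMod p → ZMod p)).toRingHom U = U := by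
    rw [hU, map_sum]
    simp only [map_wittSingle]
    refine Fintype.sum_equiv (Equiv.addRight (1 : ZMod p)) _ _ fun a => ?_
    simp
  let φ : MvPolynomial (ZMod p) (ZMod p) →ₐ[ZMod p] Polynomial (ZMod p) :=
    aeval fun _ => Polynomial.X
  have hdiag : ∀ k : Fin e, φ (U.coeff k) = if k = m' then Polynomial.X ^ p else 0 := by
    intro k
    have h1 : WittVector.map φ.toRingHom U =
        wittSingle p m (Polynomial.X : Polynomial (ZMod p)) * p := by
      rw [hU, map_sum]
      simp [map_wittSingle, φ, ZMod.card, mul_comm]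
    have h2 : φ (U.coeff k) = (WittVector.map φ.toRingHom U).coeff k := rfl
    rw [h2, h1]
    rcases hk : (k : ℕ) with _ | k'
    · rw [WittVector.mul_charP_coeff_zero, if_neg]
      rintro rfl
      omega
    · rw [WittVector.mul_charP_coeff_succ]
      have : k = m' ↔ k' = m := by rw [← Fin.val_inj]; omega
      simp only [wittSingle_coeff, this]
      rw [ite_pow, zero_pow (Fact.out : p.Prime).ne_zero]
  rw [lcoeff_apply, coeff_const_eq_of_rename_eq]
  · have : aeval (fun _ => (Polynomial.X : Polynomial (ZMod p))) (∏ k : Fin e, U.coeff k ^ l k) =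
        if l = Pi.single m' (l m') then (Polynomial.X ^ p) ^ l m' else 0 := by
      rw [← prod_single_pow, map_prod]
      refine Finset.prod_congr rfl fun k _ => ?_
      rw [map_pow, ← hdiag]
    rw [this]
    by_cases hl : l = Pi.single m' n
    · subst hl
      simp [← pow_mul]
    · rw [if_neg hl]
      split_ifs with h
      · rw [← pow_mul, Polynomial.coeff_X_pow, if_neg]
        intro h'
        have := Nat.eq_of_mul_eq_mul_left (Fact.out : p.Prime).pos h'
        exact hl (by rw [this]; exact h)
      · simp
  · rw [map_prod]
    refine Finset.prod_congr rfl fun k _ => ?_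
    rw [map_pow]
    congr 1
    exact congrArg (fun w => w.coeff k) hrot

theorem pow_pow_char_single
    (hD : ∀ i j, D i * D j = Finsupp.linearCombination (ZMod p) D (wittAlphaFinsupp p e i j))
    (hD0 : D 0 = 1) (he : 0 < e) (m : Fin e) (n : ℕ) :
    D (Pi.single ⟨0, he⟩ n) ^ p ^ (m : ℕ) = D (Pi.single m n) := by
  obtain ⟨m, hm⟩ := m
  induction m with
  | zero => simp
  | succ m ih =>
    have := ih (by omega)
    simp only at this ⊢
    rw [pow_succ, pow_mul, this]
    exact pow_char_single hD hD0 rfl n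

theorem prod_single_of_nodup
    (hD : ∀ i j, D i * D j = Finsupp.linearCombination (ZMod p) D (wittAlphaFinsupp p e i j))
    (hD0 : D 0 = 1) (i : Fin e → ℕ) (L : List (Fin e)) (hL : L.Nodup) :
    (L.map fun m => D (Pi.single m (i m))).prod = D fun m => if m ∈ L then i m else 0 := by
  induction L with
  | nil => simpa using (show (1 : Module.End (ZMod p) K) = D fun _ => 0 from hD0.symm)
  | cons a L ih =>
    rw [List.nodup_cons] at hL
    rw [List.map_cons, List.prod_cons, ih hL.2, mul_eq_add_of_disjoint hD]
    · congr 1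
      funext m
      by_cases hm : m = a
      · subst hm; simp [hL.1]
      · simp [hm]
    · intro m
      by_cases hm : m = a
      · subst hm; simp [hL.1]
      · simp [hm]

end HyperalgebraIdentities

theorem foldr_comp_eq_prod {R M : Type*} [Semiring R] [AddCommMonoid M] [Module R M]
    (L : List (Module.End R M)) : (L.map fun f : Module.End R M => (f : M → M)).foldr (· ∘ ·) id =
      (L.prod : M → M) := by
  induction L with
  | nil => rfl
  | cons f L ih =>
    rw [List.map_cons, List.foldr_cons, ih, List.prod_cons]
    rfl

/-- In a model of `W_e`-DCF, every operator `D_{(i_1,…,i_e)}` is the composition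
`D_{i_1·𝐞_1} ∘ (D_{i_2·𝐞_1})^(p) ∘ … ∘ (D_{i_e·𝐞_1})^(p^{e-1})`. -/
theorem WeDCF_eq_comp_of_first_row (p e : ℕ) [Fact p.Prime] (he : 1 ≤ e)
    (K : Type*) [Field K] [CharP K p] (D : (Fin e → ℕ) → K → K)
    (hD : IsWeDCF p e K D) (i : Fin e → ℕ) :
    D i = hsComp p e (fun n => D (Pi.single (⟨0, he⟩ : Fin e) n)) i := by
  obtain ⟨-, -, h0, hadd, -, hiter, -⟩ := hD
  let _ : Algebra (ZMod p) K := ZMod.algebra K p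
  let E : (Fin e → ℕ) → Module.End (ZMod p) K := fun i =>
    (AddMonoidHom.mk' (D i) (hadd i)).toZModLinearMap p
  have hE0 : E 0 = 1 := LinearMap.ext fun x => congrFun h0 x
  have hE : ∀ i j, E i * E j =
      Finsupp.linearCombination (ZMod p) E (wittAlphaFinsupp p e i j) := by
    intro i j
    ext x
    have h1 : (E i * E j) x = ∑ᶠ l : Fin e → ℕ, ZMod.cast (wittAlpha p e i j l) * D l x :=
      hiter i j x
    rw [h1, Finsupp.linearCombination_apply, Finsupp.sum, LinearMap.sum_apply,
      finsum_eq_sum_of_support_subset]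
    · exact Finset.sum_congr rfl fun l _ => (Algebra.smul_def (wittAlpha p e i j l) (D l x)).symm
    · intro l hl
      rw [Finset.mem_coe, Finsupp.mem_support_iff]
      intro h
      have h' : wittAlpha p e i j l = 0 := h
      exact hl (by simp [h'])
  have hprod := prod_single_of_nodup hE hE0 i (List.finRange e) (List.nodup_finRange e)
  simp only [List.mem_finRange, if_true] at hprod
  have hDE : D i = E i := rfl
  rw [hDE, ← hprod, ← foldr_comp_eq_prod, hsComp, List.ofFn_eq_map, List.map_map]
  congr 2
  funext m
  rw [Function.comp_apply, ← pow_pow_char_single hE hE0 he, Module.End.coe_pow]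
  rfl
end
end

section
/- Let K be a separably closed field of characteristic p and let (D_n : K → K)_{n∈ℕ} with D_0 = id be maps satisfying: (H1') each D_n is additive; (H2') D_n(xy) = Σ_{k+l=n} D_k(x)·D_l(y) for all x, y ∈ K and all n; (H4') D_n^(p^e) = 0 for every n ≥ 1; (H5') there exists x ∈ K with D_1^(p^e−1)(x) ≠ 0; (H6') ker D_1 ⊆ K^p; (H8') for all 𝐢 = (i_1,…,i_e), 𝐣 = (j_1,…,j_e) ∈ ℕ^e: D_{i_1} ∘ D_{i_2}^(p) ∘ … ∘ D_{i_e}^(p^{e−1}) ∘ D_{j_1} ∘ D_{j_2}^(p) ∘ … ∘ D_{j_e}^(p^{e−1}) = Σ_𝐥 α_{𝐢,𝐣}(𝐥) · D_{l_1} ∘ D_{l_2}^(p) ∘ … ∘ D_{l_e}^(p^{e−1}). For 𝐢 = (i_1,…,i_e) ∈ ℕ^e define D_𝐢 := D_{i_1} ∘ D_{i_2}^(p) ∘ … ∘ D_{i_e}^(p^{e−1}). Then (D_𝐢)_{𝐢∈ℕ^e} is a strict W_e-iterative Hasse–Schmidt derivation of dimension e on K and [K : K^p] = p^e; that is, (K,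 (D_𝐢)) is a model of W_e-DCF. -/
noncomputable section

open scoped BigOperators

/-- Witt vector addition is commutative, at the level of its polynomials mod `p`. -/
lemma rename_swap_wittHmod (p : ℕ) [Fact p.Prime] (m : ℕ) :
    MvPolynomial.rename (Prod.map (Equiv.swap (0 : Fin 2) 1) id) (wittHmod p m) =
      wittHmod p m := by
  unfold wittHmod WittVector.wittAdd
  rw [← MvPolynomial.map_rename, ← wittStructureInt_rename]
  congr 2
  simp [add_comm]

lemma mapDomain_swap_xyExp (e : ℕ) (i j : Fin e → ℕ) :
    Finsupp.mapDomain (Prod.map (Equiv.swap (0 : Fin 2) 1) id) (xyExp e i j) =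
      xyExp e j i := by
  unfold xyExp
  rw [Finsupp.mapDomain_finsetSum]
  refine Finset.sum_congr rfl fun m _ => ?_
  rw [Finsupp.mapDomain_add, Finsupp.mapDomain_single, Finsupp.mapDomain_single, add_comm]
  simp

lemma wittAlpha_comm (p : ℕ) [Fact p.Prime] (e : ℕ) (i j l : Fin e → ℕ) :
    wittAlpha p e i j l = wittAlpha p e j i l := by
  have hinj : Function.Injective (Prod.map (Equiv.swap (0 : Fin 2) 1) (id : ℕ → ℕ)) :=
    (Equiv.injective _).prodMap Function.injective_id
  unfold wittAlpha
  rw [← MvPolynomial.coeff_rename_mapDomain _ hinj, mapDomain_swap_xyExp, map_prod]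
  simp only [map_pow, rename_swap_wittHmod]

lemma foldr_comp_ofFn_eq_of_forall_ne {α : Type*} {e : ℕ} (f : Fin e → α → α) (m : Fin e)
    (h : ∀ i, i ≠ m → f i = id) : (List.ofFn f).foldr (· ∘ ·) id = f m := by
  have hid : ∀ {n : ℕ} (g : Fin n → α → α), (∀ i, g i = id) →
      (List.ofFn g).foldr (· ∘ ·) id = id := by
    intro n g hg
    induction n with
    | zero => simp
    | succ n ih =>
      rw [List.ofFn_succ, List.foldr_cons, ih _ fun i => hg i.succ, hg 0]
      rfl
  induction e with
  | zero => exact m.elim0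
  | succ e ih =>
    rw [List.ofFn_succ, List.foldr_cons]
    induction m using Fin.cases with
    | zero =>
      rw [hid _ fun i => h _ (Fin.succ_ne_zero i)]
      rfl
    | succ m =>
      rw [ih (fun i => f i.succ) m fun i hi => h _ fun hc => hi (Fin.succ_injective _ hc),
        h 0 (Fin.succ_ne_zero m).symm]
      rfl

lemma hsComp_single {K : Type*} (p e : ℕ) (D : ℕ → K → K) (h0 : D 0 = id) (m : Fin e) (n : ℕ) :
    hsComp p e D (Pi.single m n) = (D n)^[p ^ (m : ℕ)] := by
  unfold hsComp
  rw [foldr_comp_ofFn_eq_of_forall_ne _ m]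
  · simp
  · intro i hi
    simp [Pi.single_eq_of_ne hi, h0]

lemma foldr_comp_ofFn_add {K : Type*} [Add K] {e : ℕ} (f : Fin e → K → K)
    (hf : ∀ m x y, f m (x + y) = f m x + f m y) (x y : K) :
    (List.ofFn f).foldr (· ∘ ·) id (x + y) =
      (List.ofFn f).foldr (· ∘ ·) id x + (List.ofFn f).foldr (· ∘ ·) id y := by
  induction e with
  | zero => simp
  | succ e ih =>
    simp only [List.ofFn_succ, List.foldr_cons, Function.comp_apply]
    rw [ih _ fun m => hf m.succ, hf]

lemma iterate_map_add' {K : Type*} [Add K] (f : K → K) (hf : ∀ x y, f (x + y) = f x + f y)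
    (n : ℕ) (x y : K) : f^[n] (x + y) = f^[n] x + f^[n] y :=
  iterate_map_add (AddHom.mk f hf) n x y

lemma sum_Iic_fin_succ {M : Type*} [AddCommMonoid M] {e : ℕ} (v : Fin (e + 1) → ℕ)
    (F : (Fin (e + 1) → ℕ) → M) :
    ∑ k ∈ Finset.Iic v, F k =
      ∑ k ∈ Finset.Iic (fun m : Fin e => v m.succ), ∑ j ∈ Finset.range (v 0 + 1),
        F (Fin.cons j k) := by
  rw [← Finset.sum_product']
  refine Finset.sum_nbij' (fun k => (fun m => k m.succ, k 0)) (fun q => Fin.cons q.2 q.1)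
    ?_ ?_ ?_ ?_ ?_
  · intro k hk
    simp only [Finset.mem_Iic, Finset.mem_product, Finset.mem_range, Pi.le_def] at hk ⊢
    exact ⟨fun m => hk m.succ, Nat.lt_succ_of_le (hk 0)⟩
  · rintro ⟨k, j⟩ hk
    simp only [Finset.mem_Iic, Finset.mem_product, Finset.mem_range, Pi.le_def] at hk ⊢
    intro m
    induction m using Fin.cases with
    | zero => exact Nat.le_of_lt_succ hk.2
    | succ m => exact hk.1 m
  · intro k _
    exact Fin.cons_self_tail k
  · rintro ⟨k, j⟩ _
    simp
  · intro k _
    exact congrArg F (Fin.cons_self_tail k).symm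

/-- A composition of one-variable Hasse–Schmidt derivations satisfies the multivariate
Leibniz rule. -/
lemma foldr_comp_ofFn_mul {K : Type*} [CommRing K] {e : ℕ} (E : Fin e → ℕ → K → K)
    (hadd : ∀ m n x y, E m n (x + y) = E m n x + E m n y)
    (hmul : ∀ m n x y, E m n (x * y) =
      ∑ k ∈ Finset.range (n + 1), E m k x * E m (n - k) y)
    (v : Fin e → ℕ) (x y : K) :
    (List.ofFn fun m => E m (v m)).foldr (· ∘ ·) id (x * y) =
      ∑ k ∈ Finset.Iic v, (List.ofFn fun m => E m (k m)).foldr (· ∘ ·) id x *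
        (List.ofFn fun m => E m ((v - k) m)).foldr (· ∘ ·) id y := by
  induction e with
  | zero =>
    have : Finset.Iic v = {v} := by
      ext k
      simp [Subsingleton.elim k v]
    simp [this]
  | succ e ih =>
    rw [sum_Iic_fin_succ]
    simp only [List.ofFn_succ, List.foldr_cons, Function.comp_apply]
    rw [ih (fun m => E m.succ) (fun m => hadd _) (fun m => hmul _)]
    have hs := fun s f => map_sum (AddMonoidHom.mk' (E 0 (v 0)) (hadd 0 (v 0)))
      (ι := Fin e → ℕ) f s
    simp only [AddMonoidHom.mk'_apply] at hs
    rw [hs]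
    refine Finset.sum_congr rfl fun k _ => ?_
    rw [hmul]
    simp

/-- The freshman's dream for a finite sum of pairwise commuting elements. -/
lemma sum_pow_char_pow_of_commute {R ι : Type*} [Ring R] (p : ℕ) [Fact p.Prime] [CharP R p]
    (n : ℕ) (s : Finset ι) (f : ι → R) (h : ∀ i j, Commute (f i) (f j)) :
    (∑ i ∈ s, f i) ^ p ^ n = ∑ i ∈ s, f i ^ p ^ n := by
  classical
  induction s using Finset.induction_on with
  | empty => simp [(Fact.out : p.Prime).ne_zero]
  | insert a s ha ih =>
    rw [Finset.sum_insert ha, Finset.sum_insert ha,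
      add_pow_char_pow_of_commute (p := p) (n := n)
        (Commute.sum_right _ _ _ fun i _ => h a i), ih]

/-- Precomposition of a function of two variables with `f` and `g`, as a linear endomorphism. -/
def precompTwo {K : Type*} [Field K] (f g : K → K) : Module.End K (K → K → K) where
  toFun F x y := F (f x) (g y)
  map_add' _ _ := rfl
  map_smul' _ _ := rfl

lemma precompTwo_pow_apply {K : Type*} [Field K] (f g : K → K) (n : ℕ) (F : K → K → K)
    (x y : K) : (precompTwo f g ^ n) F x y = F (f^[n] x) (g^[n] y) := by
  induction n generalizing F x y with
  | zero => rfl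
  | succ n ih =>
    rw [pow_succ, Module.End.mul_apply, ih, Function.iterate_succ_apply',
      Function.iterate_succ_apply']
    rfl

/-- In characteristic `p`, the `p ^ m`-fold iterates of a commuting family satisfying the
Leibniz rule satisfy the Leibniz rule. -/
lemma iterate_prime_pow_mul {K : Type*} [Field K] (p : ℕ) [Fact p.Prime] [CharP K p]
    (D : ℕ → K → K) (hadd : ∀ n x y, D n (x + y) = D n x + D n y)
    (hmul : ∀ n x y, D n (x * y) = ∑ k ∈ Finset.range (n + 1), D k x * D (n - k) y)
    (hcomm : ∀ i j x, D i (D j x) = D j (D i x)) (m n : ℕ) (x y : K) :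
    (D n)^[p ^ m] (x * y) =
      ∑ k ∈ Finset.range (n + 1), (D k)^[p ^ m] x * (D (n - k))^[p ^ m] y := by
  have : CharP (Module.End K (K → K → K)) p :=
    charP_of_injective_algebraMap (algebraMap K (Module.End K (K → K → K))).injective p
  set T : ℕ → Module.End K (K → K → K) := fun k => precompTwo (D k) (D (n - k)) with hT
  have hTc : ∀ i j, Commute (T i) (T j) := by
    intro i j
    refine LinearMap.ext fun F => ?_
    funext a b
    change F (D j (D i a)) (D (n - j) (D (n - i) b)) = F (D i (D j a)) (D (n - i) (D (n - j) b))
    rw [hcomm j i, hcomm (n - j)]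
  have hsum : ∀ (s : Finset ℕ) (S : ℕ → Module.End K (K → K → K)) (F : K → K → K) (a b : K),
      (∑ k ∈ s, S k) F a b = ∑ k ∈ s, S k F a b := by
    intro s S F a b
    simp [LinearMap.sum_apply, Finset.sum_apply]
  have hpow : ∀ N a b, ((∑ k ∈ Finset.range (n + 1), T k) ^ N) (fun a b => a * b) a b =
      (D n)^[N] (a * b) := by
    intro N
    induction N with
    | zero => intros; rfl
    | succ N ih =>
      intro a b
      rw [pow_succ', Module.End.mul_apply, hsum, Function.iterate_succ_apply]
      rw [hmul]
      have hs := fun f => map_sum (AddMonoidHom.mk' ((D n)^[N])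
        (iterate_map_add' _ (hadd n) N)) (ι := ℕ) f (Finset.range (n + 1))
      simp only [AddMonoidHom.mk'_apply] at hs
      rw [hs]
      exact Finset.sum_congr rfl fun k _ => ih _ _
  rw [← hpow, sum_pow_char_pow_of_commute p m _ T hTc, hsum]
  exact Finset.sum_congr rfl fun k _ => precompTwo_pow_apply _ _ _ _ _ _

/-- A nilpotent endomorphism of index `N` whose kernel is a line acts on a space of
dimension `N`. -/
lemma finrank_eq_of_ker_le_span_singleton {C V : Type*} [Field C] [AddCommGroup V] [Module C V]
    (d : Module.End C V) (N : ℕ) (hN : d ^ N = 0) (x : V) (hx : (d ^ (N - 1)) x ≠ 0)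
    (hker : ∀ y z, d y = 0 → d z = 0 → z ≠ 0 → ∃ c : C, y = c • z) :
    Module.finrank C V = N := by
  have hzero : ∀ n, N ≤ n → (d ^ n) x = 0 := fun n hn => by
    rw [pow_eq_zero_of_le hn hN, LinearMap.zero_apply]
  have hcomp : ∀ a b z, (d ^ a) ((d ^ b) z) = (d ^ (a + b)) z := fun a b z => by
    rw [pow_add, Module.End.mul_apply]
  have hspan : ∀ n, n ≤ N → ∀ y, (d ^ n) y = 0 →
      y ∈ Submodule.span C (Set.range fun i : Fin n => (d ^ (N - 1 - i)) x) := by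
    intro n
    induction n with
    | zero => intro _ y hy; simp_all
    | succ n ih =>
      intro hn y hy
      obtain ⟨c, hc⟩ := hker ((d ^ n) y) ((d ^ (N - 1)) x)
        (by rw [← hy, pow_succ', Module.End.mul_apply])
        (by
          rw [← Module.End.mul_apply, ← pow_succ']
          exact hzero _ (by lia)) hx
      have h := ih (by lia) (y - c • (d ^ (N - 1 - n)) x) (by
        rw [map_sub, map_smul, hcomp, show n + (N - 1 - n) = N - 1 by lia, hc, sub_self])
      rw [← sub_add_cancel y (c • (d ^ (N - 1 - n)) x)]
      refine Submodule.add_mem _ (Submodule.span_mono ?_ h)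
        (Submodule.smul_mem _ _ (Submodule.subset_span ⟨Fin.last n, rfl⟩))
      rintro _ ⟨i, rfl⟩
      exact ⟨i.castSucc, rfl⟩
  have hli : ∀ n, n ≤ N →
      LinearIndependent C (fun i : Fin n => (d ^ (N - 1 - i)) x) := by
    intro n
    induction n with
    | zero => intro _; exact linearIndependent_empty_type
    | succ n ih =>
      intro hn
      rw [linearIndependent_finSucc']
      refine ⟨ih (by lia), fun hmem => hx ?_⟩
      have hle : Submodule.span C (Set.range (Fin.init
          fun i : Fin (n + 1) => (d ^ (N - 1 - i)) x)) ≤ LinearMap.ker (d ^ n) := by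
        rw [Submodule.span_le]
        rintro _ ⟨i, rfl⟩
        change (d ^ n) ((d ^ (N - 1 - (i : ℕ))) x) = 0
        rw [hcomp]
        exact hzero _ (by have := i.2; lia)
      have h : (d ^ n) ((d ^ (N - 1 - n)) x) = 0 := hle hmem
      rwa [hcomp, show n + (N - 1 - n) = N - 1 by lia] at h
  have b := Module.Basis.mk (hli N le_rfl) fun y _ => hspan N le_rfl y (by rw [hN]; rfl)
  simpa using Module.finrank_eq_card_basis b

/-- If `K` is a separably closed field of characteristic `p` and `(D_n)_{n∈ℕ}`, `D_0 = id`,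
satisfies the axioms H1', H2', H4', H5', H6' and the `W_e`-iterativity axioms H8', then the
family `D_𝐢 := D_{i_1} ∘ D_{i_2}^(p) ∘ … ∘ D_{i_e}^(p^{e-1})` is a strict `W_e`-iterative
Hasse–Schmidt derivation of dimension `e` on `K` with `[K : K^p] = p^e`, i.e. `(K, (D_𝐢))`
is a model of `W_e`-DCF. -/
theorem isWeDCF_of_SHF_axioms (p e : ℕ) [Fact p.Prime] (he : 1 ≤ e)
    (K : Type*) [Field K] [CharP K p] (hsc : IsSepClosed K)
    (D : ℕ → K → K) (h0 : D 0 = id)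
    (h1 : ∀ n : ℕ, ∀ x y : K, D n (x + y) = D n x + D n y)
    (h2 : ∀ n : ℕ, ∀ x y : K,
      D n (x * y) = ∑ k ∈ Finset.range (n + 1), D k x * D (n - k) y)
    (h4 : ∀ n : ℕ, 1 ≤ n → ∀ x : K, (D n)^[p ^ e] x = 0)
    (h5 : ∃ x : K, (D 1)^[p ^ e - 1] x ≠ 0)
    (h6 : ∀ x : K, D 1 x = 0 → ∃ y : K, x = y ^ p)
    (h8 : ∀ i j : Fin e → ℕ, ∀ x : K,
      hsComp p e D i (hsComp p e D j x) =
        ∑ᶠ l : Fin e → ℕ, ZMod.cast (wittAlpha p e i j l) * hsComp p e D l x) :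
    IsWeDCF p e K (fun i => hsComp p e D i) := by
  have hp : p.Prime := Fact.out
  have hcomm : ∀ i j x, D i (D j x) = D j (D i x) := by
    intro i j x
    have h := fun n => hsComp_single p e D h0 ⟨0, he⟩ n
    simp only [pow_zero, Function.iterate_one] at h
    have hij := h8 (Pi.single ⟨0, he⟩ i) (Pi.single ⟨0, he⟩ j) x
    have hji := h8 (Pi.single ⟨0, he⟩ j) (Pi.single ⟨0, he⟩ i) x
    simp only [wittAlpha_comm p e (Pi.single ⟨0, he⟩ j)] at hji
    rw [← hji, h, h] at hij
    exact hij
  have hder : ∀ x y, D 1 (x * y) = x * D 1 y + D 1 x * y := by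
    intro x y
    simp [h2, Finset.sum_range_succ, h0]
  have hD1 : ∀ y, D 1 (y ^ p) = 0 := by
    have hpow : ∀ (y : K) (n : ℕ), D 1 (y ^ (n + 1)) = (n + 1) * y ^ n * D 1 y := by
      intro y n
      induction n with
      | zero => simp
      | succ n ih =>
        rw [pow_succ, hder, ih]
        push_cast
        ring
    intro y
    obtain ⟨n, rfl⟩ := Nat.exists_eq_succ_of_ne_zero hp.ne_zero
    have hc : ((n + 1 : ℕ) : K) = 0 := CharP.cast_eq_zero K (n + 1)
    push_cast at hc
    rw [Nat.succ_eq_add_one, hpow, hc]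
    ring
  refine ⟨hsc, ?_, ?_, ?_, ?_, h8, ?_⟩
  · let d : Module.End (frobenius K p).fieldRange K :=
      { toFun := D 1
        map_add' := h1 1
        map_smul' := by
          rintro ⟨_, c, rfl⟩ x
          change D 1 (c ^ p * x) = c ^ p * D 1 x
          rw [hder, hD1, zero_mul, add_zero] }
    have hd : ∀ n x, (d ^ n) x = (D 1)^[n] x := fun n x => Module.End.pow_apply d n x
    obtain ⟨x, hx⟩ := h5
    refine finrank_eq_of_ker_le_span_singleton d (p ^ e)
      (LinearMap.ext fun y => (hd _ _).trans (h4 1 le_rfl y)) x (by rwa [hd]) ?_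
    intro y z hy hz hz0
    obtain ⟨a, rfl⟩ := h6 y hy
    obtain ⟨b, rfl⟩ := h6 z hz
    refine ⟨⟨(a / b) ^ p, a / b, rfl⟩, ?_⟩
    change a ^ p = (a / b) ^ p * b ^ p
    rw [div_pow, div_mul_cancel₀ _ hz0]
  · have h := hsComp_single p e D h0 ⟨0, he⟩ 0
    rw [Pi.single_zero] at h
    simpa [h0] using h
  · exact fun i => foldr_comp_ofFn_add _ fun m => iterate_map_add' _ (h1 (i m)) _
  · exact fun i => foldr_comp_ofFn_mul (fun m n => (D n)^[p ^ (m : ℕ)])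
      (fun m n => iterate_map_add' _ (h1 n) _)
      (fun m => iterate_prime_pow_mul p D h1 h2 hcomm m) i
  · intro x
    simp only [hsComp_single p e D h0]
    refine ⟨fun h => h6 x (by simpa using h ⟨0, he⟩), ?_⟩
    rintro ⟨y, rfl⟩ m
    obtain ⟨n, hn⟩ := Nat.exists_eq_succ_of_ne_zero (pow_ne_zero (m : ℕ) hp.ne_zero)
    have hz : D 1 0 = 0 := by simpa using h1 1 0 0
    rw [hn, Function.iterate_succ_apply, hD1]
    exact Function.iterate_fixed hz n
end
end

section
/- Let (K, D) be a model of W_e-DCF, write ∂_m := D_{𝐞_m} for 1 ≤ m ≤ e, set F_m := ⋂_{j=m}^{e} ker ∂_j for 1 ≤ m ≤ e and F_{e+1} := K. Then each F_m is a subfield of K and [F_{m+1} : F_m] = p for every 1 ≤ m ≤ e. -/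
noncomputable section

open scoped BigOperators

open MvPolynomial in
/-- The specialization of the `n`-th Witt addition polynomial at vectors supported in place `m`. -/
def wittAddAt (p : ℕ) [Fact p.Prime] (m n : ℕ) : MvPolynomial (Fin 2) ℤ :=
  killCompl (Prod.mk_left_injective m) (WittVector.wittAdd p n)

section wittAddAt

open MvPolynomial

theorem coeff_mapDomain_eq_coeff_killCompl {σ τ R : Type*} [CommSemiring R] {f : σ → τ}
    (hf : Function.Injective f) (P : MvPolynomial τ R) (d : σ →₀ ℕ) :
    coeff (d.mapDomain f) P = coeff d (killCompl hf P) := by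
  classical
  induction P using MvPolynomial.induction_on' with
  | add P Q hP hQ => simp [hP, hQ]
  | monomial s c =>
    by_cases hs : (s.support : Set τ) ⊆ Set.range f
    · have h : (s.comapDomain f hf.injOn).mapDomain f = s :=
        Finsupp.mapDomain_comapDomain f hf s hs
      rw [← h, killCompl_monomial_mapDomain]
      simp only [coeff_monomial, (Finsupp.mapDomain_injective hf).eq_iff]
    · rw [killCompl_monomial_eq_zero_of_not_subset hf c hs, coeff_monomial, if_neg, coeff_zero]
      rintro rfl
      apply hs
      intro a ha
      obtain ⟨b, -, rfl⟩ := Finset.mem_image.1 (Finsupp.mapDomain_support ha)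
      exact ⟨b, rfl⟩

variable (p : ℕ) [hp : Fact p.Prime]

theorem killCompl_mk_X (m n : ℕ) (a : Fin 2) :
    killCompl (R := ℤ) (Prod.mk_left_injective m) (X (a, n) : MvPolynomial (Fin 2 × ℕ) ℤ) =
      if n = m then X a else 0 := by
  split_ifs with h
  · subst h
    have := killCompl_rename_app (R := ℤ) (Prod.mk_left_injective (α := Fin 2) n) (X a)
    rwa [rename_X] at this
  · rw [killCompl, aeval_X, dif_neg]
    rintro ⟨b, hb⟩
    exact h (congrArg Prod.snd hb).symm

theorem sum_wittAddAt_pow (m n : ℕ) :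
    ∑ i ∈ Finset.range (n + 1), C ((p : ℤ) ^ i) * wittAddAt p m i ^ p ^ (n - i) =
      if m ≤ n then C ((p : ℤ) ^ m) * (X 0 ^ p ^ (n - m) + X 1 ^ p ^ (n - m)) else 0 := by
  have h := congrArg (killCompl (Prod.mk_left_injective m))
    (wittStructureInt_prop p (X 0 + X 1 : MvPolynomial (Fin 2) ℤ) n)
  simp only [wittPolynomial_eq_sum_C_mul_X_pow, map_sum, map_mul, map_pow, bind₁_X_right,
    map_add, rename_X, algHom_C, killCompl_mk_X, algebraMap_eq] at h
  simp only [wittAddAt, WittVector.wittAdd]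
  simp only [map_pow]
  rw [h, ← Finset.sum_add_distrib]
  split_ifs with hmn
  · rw [Finset.sum_eq_single m]
    · simp; ring
    · intro b _ hb
      simp [hb, hp.out.ne_zero]
    · intro hm
      exact absurd (Finset.mem_range.2 (by omega)) hm
  · refine Finset.sum_eq_zero fun i hi => ?_
    have : i ≠ m := by have := Finset.mem_range.1 hi; omega
    simp [this, hp.out.ne_zero]

theorem C_mul_wittAddAt (m n : ℕ) :
    C ((p : ℤ) ^ n) * wittAddAt p m n =
      (if m ≤ n then C ((p : ℤ) ^ m) * (X 0 ^ p ^ (n - m) + X 1 ^ p ^ (n - m)) else 0) -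
        ∑ i ∈ Finset.range n, C ((p : ℤ) ^ i) * wittAddAt p m i ^ p ^ (n - i) := by
  rw [← sum_wittAddAt_pow, Finset.sum_range_succ]
  simp

theorem C_pow_ne_zero (n : ℕ) : (C ((p : ℤ) ^ n) : MvPolynomial (Fin 2) ℤ) ≠ 0 := by
  rw [Ne, C_eq_zero]
  exact pow_ne_zero _ (by exact_mod_cast hp.out.ne_zero)

theorem wittAddAt_eq_zero {m n : ℕ} (h : n < m) : wittAddAt p m n = 0 := by
  induction n using Nat.strong_induction_on with
  | _ n ih =>
    have := C_mul_wittAddAt p m n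
    rw [if_neg (by omega), Finset.sum_eq_zero, sub_zero] at this
    · exact (mul_eq_zero.1 this).resolve_left (C_pow_ne_zero p n)
    · intro i hi
      have hi := Finset.mem_range.1 hi
      rw [ih i hi (hi.trans h), zero_pow (pow_ne_zero _ hp.out.ne_zero), mul_zero]

theorem wittAddAt_self (m : ℕ) : wittAddAt p m m = X 0 + X 1 := by
  have := C_mul_wittAddAt p m m
  rw [if_pos le_rfl, Finset.sum_eq_zero, sub_zero] at this
  · simpa using mul_left_cancel₀ (C_pow_ne_zero p m) this
  · intro i hi
    rw [wittAddAt_eq_zero p (Finset.mem_range.1 hi), zero_pow (pow_ne_zero _ hp.out.ne_zero),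
      mul_zero]

theorem C_mul_wittAddAt_succ (m : ℕ) :
    C (p : ℤ) * wittAddAt p m (m + 1) = X 0 ^ p + X 1 ^ p - (X 0 + X 1) ^ p := by
  have := C_mul_wittAddAt p m (m + 1)
  rw [if_pos (by omega), Finset.sum_range_succ, Finset.sum_eq_zero, wittAddAt_self] at this
  · apply mul_left_cancel₀ (C_pow_ne_zero p m)
    rw [← mul_assoc, ← C_mul, ← pow_succ, this]
    simp
    ring
  · intro i hi
    rw [wittAddAt_eq_zero p (Finset.mem_range.1 hi), zero_pow (pow_ne_zero _ hp.out.ne_zero),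
      mul_zero]

theorem isHomogeneous_of_C_mul {σ : Type*} {φ : MvPolynomial σ ℤ} {c : ℤ} (hc : c ≠ 0) {n : ℕ}
    (h : (C c * φ).IsHomogeneous n) : φ.IsHomogeneous n := by
  intro d hd
  exact h (by rw [coeff_C_mul]; exact mul_ne_zero hc hd)

theorem wittAddAt_isHomogeneous {m n : ℕ} (h : m ≤ n) :
    (wittAddAt p m n).IsHomogeneous (p ^ (n - m)) := by
  induction n using Nat.strong_induction_on with
  | _ n ih =>
    apply isHomogeneous_of_C_mul (c := (p : ℤ) ^ n)
      (pow_ne_zero _ (by exact_mod_cast hp.out.ne_zero))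
    rw [C_mul_wittAddAt, if_pos h]
    refine IsHomogeneous.sub (IsHomogeneous.C_mul
      ((isHomogeneous_X_pow _ _).add (isHomogeneous_X_pow _ _)) _) (IsHomogeneous.sum _ _ _ ?_)
    intro i hi
    have hi := Finset.mem_range.1 hi
    apply IsHomogeneous.C_mul
    by_cases hmi : m ≤ i
    · have := (ih i hi hmi).pow (p ^ (n - i))
      rwa [← pow_add, show i - m + (n - i) = n - m by omega] at this
    · rw [wittAddAt_eq_zero p (by omega), zero_pow (pow_ne_zero _ hp.out.ne_zero)]
      exact isHomogeneous_zero _ _ _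

/-- The exponent of the monomial `X * Y ^ k`. -/
def expXY (k : ℕ) : Fin 2 →₀ ℕ := Finsupp.single 0 1 + Finsupp.single 1 k

theorem degree_expXY (k : ℕ) : (expXY k).degree = k + 1 := by
  simp [expXY, add_comm]

theorem coeff_expXY_add_pow (n k : ℕ) (h : n = k + 1) :
    coeff (expXY k) ((X 0 + X 1 : MvPolynomial (Fin 2) ℤ) ^ n) = n := by
  subst h
  have key : ∀ j : ℕ, (X 0 ^ j * X 1 ^ (k + 1 - j) : MvPolynomial (Fin 2) ℤ) =
      monomial (Finsupp.single 0 j + Finsupp.single 1 (k + 1 - j)) 1 := by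
    intro j
    rw [X_pow_eq_monomial, X_pow_eq_monomial, monomial_mul, one_mul]
  rw [add_pow, coeff_sum, Finset.sum_eq_single 1]
  · rw [key, ← map_natCast (C : ℤ →+* MvPolynomial (Fin 2) ℤ), mul_comm, coeff_C_mul]
    simp [expXY]
  · intro j _ hj
    rw [key, ← map_natCast (C : ℤ →+* MvPolynomial (Fin 2) ℤ), mul_comm, coeff_C_mul, coeff_monomial,
      if_neg, mul_zero]
    intro h
    apply hj
    simpa [expXY] using DFunLike.congr_fun h 0
  · intro h
    exact absurd (Finset.mem_range.2 (by omega)) h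

theorem coeff_expXY_wittAddAt_succ (m k : ℕ) (h : k + 1 = p) :
    coeff (expXY k) (wittAddAt p m (m + 1)) = -1 := by
  have hp1 := hp.out.one_lt
  have hp0 : (p : ℤ) ≠ 0 := by exact_mod_cast hp.out.ne_zero
  apply mul_left_cancel₀ hp0
  rw [← coeff_C_mul, C_mul_wittAddAt_succ, coeff_sub, coeff_add, coeff_X_pow, coeff_X_pow,
    coeff_expXY_add_pow p k h.symm, if_neg, if_neg]
  · ring
  · intro h'
    have := DFunLike.congr_fun h' 0
    simp [expXY] at this
  · intro h'
    have := DFunLike.congr_fun h' 0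
    simp [expXY] at this
    omega

theorem xyExp_single (e : ℕ) (m : Fin e) (k : ℕ) :
    xyExp e (Pi.single m 1) (Pi.single m k) =
      (expXY k).mapDomain fun a => ((a, (m : ℕ)) : Fin 2 × ℕ) := by
  rw [xyExp, Finset.sum_eq_single m]
  · simp [expXY, Finsupp.mapDomain_add, Finsupp.mapDomain_single]
  · intro b _ hb
    simp [hb]
  · simp

theorem wittAlpha_single_single (e : ℕ) (m : Fin e) (k : ℕ) (l : Fin e → ℕ) :
    wittAlpha p e (Pi.single m 1) (Pi.single m k) l =
      ((coeff (expXY k) (∏ n : Fin e, wittAddAt p m n ^ l n) : ℤ) : ZMod p) := by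
  have h : (∏ n : Fin e, wittHmod p n ^ l n) =
      map (Int.castRingHom (ZMod p)) (∏ n : Fin e, WittVector.wittAdd p n ^ l n) := by
    simp [wittHmod, map_prod]
  rw [wittAlpha, h, coeff_map, xyExp_single,
    coeff_mapDomain_eq_coeff_killCompl (Prod.mk_left_injective (m : ℕ))]
  simp [wittAddAt, map_prod]

theorem eq_single_of_coeff_expXY_ne_zero {e : ℕ} {m : Fin e} {k : ℕ} (hk : k + 1 ≤ p)
    {l : Fin e → ℕ} (h : coeff (expXY k) (∏ n : Fin e, wittAddAt p m n ^ l n) ≠ 0) :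
    l = Pi.single m (k + 1) ∨
      (k + 1 = p ∧ ∃ n : Fin e, (n : ℕ) = m + 1 ∧ l = Pi.single n 1) := by
  set d : Fin e → ℕ := fun n => if n < m then p + 1 else p ^ ((n : ℕ) - m) with hd
  have hom : ∀ n : Fin e, (wittAddAt p m n).IsHomogeneous (d n) := by
    intro n
    by_cases hn : n < m
    · rw [wittAddAt_eq_zero p hn]
      exact isHomogeneous_zero _ _ _
    · simp only [hd, if_neg hn]
      exact wittAddAt_isHomogeneous p (by simpa using hn)
  have hsum : ∑ n, d n * l n = k + 1 := by
    have := IsHomogeneous.prod Finset.univ (fun n : Fin e => wittAddAt p m n ^ l n)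
      (fun n => d n * l n) (fun n _ => (hom n).pow _)
    by_contra hne
    exact h (this.coeff_eq_zero (by rw [degree_expXY]; exact Ne.symm hne))
  have hle : ∀ n, d n * l n ≤ k + 1 := fun n =>
    hsum ▸ Finset.single_le_sum (f := fun n => d n * l n) (fun _ _ => Nat.zero_le _)
      (Finset.mem_univ n)
  by_cases hl : ∀ n, n ≠ m → l n = 0
  · left
    have hm : l m = k + 1 := by
      rw [Finset.sum_eq_single m (fun n _ hn => by rw [hl n hn, mul_zero]) (by simp)] at hsum
      simpa [hd] using hsum
    ext n
    by_cases hn : n = m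
    · subst hn; simpa using hm
    · simp [hn, hl n hn]
  · right
    push Not at hl
    obtain ⟨n, hnm, hln⟩ := hl
    have hdn : d n ≤ k + 1 := (Nat.le_mul_of_pos_right _ (Nat.pos_of_ne_zero hln)).trans (hle n)
    have hlt : m < n := by
      rcases lt_or_gt_of_ne hnm with hn | hn
      · simp only [hd, if_pos hn] at hdn
        omega
      · exact hn
    have hdn' : d n = p ^ ((n : ℕ) - m) := if_neg (not_lt.2 hlt.le)
    have hval : (m : ℕ) < n := hlt
    have hn1 : (n : ℕ) - m = 1 := by
      have : p ^ ((n : ℕ) - m) ≤ p ^ 1 := by rw [pow_one]; omega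
      have := (Nat.pow_le_pow_iff_right hp.out.one_lt).1 this
      omega
    have hdp : d n = p := by rw [hdn', hn1, pow_one]
    have hkp : k + 1 = p := by omega
    have hl1 : l n = 1 := by
      have h1 := hle n
      rw [hdp, hkp] at h1
      have := Nat.le_of_mul_le_mul_left (h1.trans_eq (mul_one p).symm) hp.out.pos
      omega
    refine ⟨hkp, n, by omega, ?_⟩
    have hrest : ∀ i, i ≠ n → l i = 0 := by
      intro i hi
      have h2 : d i * l i + d n * l n ≤ ∑ n, d n * l n :=
        Finset.add_le_sum (f := fun n => d n * l n) (fun _ _ => Nat.zero_le _)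
          (Finset.mem_univ i) (Finset.mem_univ n) hi
      rw [hsum, hdp, hl1, hkp] at h2
      have h0 : d i * l i = 0 := by omega
      refine (mul_eq_zero.1 h0).resolve_left ?_
      simp only [hd]
      split_ifs
      · simp
      · exact pow_ne_zero _ hp.out.ne_zero
    ext i
    by_cases hi : i = n
    · subst hi; simpa using hl1
    · simp [hi, hrest i hi]

theorem wittAlpha_single_self (e : ℕ) (m : Fin e) (k : ℕ) :
    wittAlpha p e (Pi.single m 1) (Pi.single m k) (Pi.single m (k + 1)) = (k + 1 : ℕ) := by
  rw [wittAlpha_single_single, Finset.prod_eq_single m]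
  · rw [wittAddAt_self, Pi.single_eq_same, coeff_expXY_add_pow _ _ rfl]
    simp
  · intro b _ hb
    simp [hb]
  · simp

theorem wittAlpha_single_succ (e : ℕ) {m n : Fin e} (hn : (n : ℕ) = m + 1) {k : ℕ}
    (hk : k + 1 = p) :
    wittAlpha p e (Pi.single m 1) (Pi.single m k) (Pi.single n 1) = -1 := by
  rw [wittAlpha_single_single, Finset.prod_eq_single n]
  · rw [hn, Pi.single_eq_same, pow_one, coeff_expXY_wittAddAt_succ p m k hk]
    simp
  · intro b _ hb
    simp [hb]
  · simp

end wittAddAt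

section Constants

variable {K : Type*} [Field K]

/-- The subfield of constants of a derivation on a field. -/
def Derivation.constants (d : Derivation ℤ K K) : Subfield K where
  carrier := {x | d x = 0}
  zero_mem' := map_zero d
  one_mem' := d.map_one_eq_zero
  add_mem' {x y} hx hy := by
    simp only [Set.mem_ofPred_eq] at *
    rw [map_add, hx, hy, add_zero]
  neg_mem' {x} hx := by
    simp only [Set.mem_ofPred_eq] at *
    rw [map_neg, hx, neg_zero]
  mul_mem' {x y} hx hy := by
    simp only [Set.mem_ofPred_eq] at *
    rw [d.leibniz, hx, hy, smul_zero, smul_zero, add_zero]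
  inv_mem' x hx := by
    simp only [Set.mem_ofPred_eq] at *
    rw [d.leibniz_inv, hx, smul_zero]

@[simp]
theorem Derivation.mem_constants {d : Derivation ℤ K K} {x : K} : x ∈ d.constants ↔ d x = 0 :=
  Iff.rfl

/-- A derivation as a linear map over its field of constants. -/
def Derivation.constantsLinearMap (d : Derivation ℤ K K) : K →ₗ[d.constants] K where
  toFun := d
  map_add' := map_add d
  map_smul' c x := by
    have hc : d (c : K) = 0 := c.2
    simp [Subfield.smul_def, d.leibniz, hc]

theorem LinearMap.finrank_ker_pow_le {F V : Type*} [Field F] [AddCommGroup V] [Module F V]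
    [FiniteDimensional F V] (f : V →ₗ[F] V) (k : ℕ) :
    Module.finrank F (ker (f ^ k)) ≤ k * Module.finrank F (ker f) := by
  induction k with
  | zero =>
    have h : ker (1 : V →ₗ[F] V) = ⊥ := ker_id
    rw [pow_zero, h]
    simp
  | succ k ih =>
    rw [← finrank_range_add_finrank_ker (f.domRestrict (ker (f ^ (k + 1)))), Nat.succ_mul]
    refine add_le_add (le_trans (Submodule.finrank_mono ?_) ih) ?_
    · rintro _ ⟨⟨x, hx⟩, rfl⟩
      rw [mem_ker, pow_succ, Module.End.mul_apply] at hx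
      exact hx
    · rw [← Submodule.finrank_map_subtype_eq]
      refine Submodule.finrank_mono ?_
      rintro _ ⟨x, hx, rfl⟩
      exact hx

theorem Derivation.relfinrank_constants_le (d : Derivation ℤ K K)
    [FiniteDimensional d.constants K] {B : Subfield K} (hB : d.constants ≤ B) {k : ℕ}
    (hk : ∀ x ∈ B, d^[k] x = 0) : Subfield.relfinrank d.constants B ≤ k := by
  have hker : Module.finrank d.constants (LinearMap.ker d.constantsLinearMap) ≤ 1 :=
    finrank_le_one ⟨1, d.map_one_eq_zero⟩ fun w => ⟨⟨w, w.2⟩, Subtype.ext (mul_one _)⟩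
  rw [Subfield.relfinrank_eq_finrank_of_le hB]
  calc Module.finrank d.constants (Subfield.extendScalars hB)
      ≤ Module.finrank d.constants (LinearMap.ker (d.constantsLinearMap ^ k)) := by
        refine Submodule.finrank_mono (s := (Subfield.extendScalars hB).toSubmodule) ?_
        intro x hx
        rw [LinearMap.mem_ker, Module.End.pow_apply]
        exact hk x hx
    _ ≤ k * _ := LinearMap.finrank_ker_pow_le _ _
    _ ≤ k := by simpa using Nat.mul_le_mul_left k hker

theorem Subfield.prod_relfinrank {n : ℕ} (F : Fin (n + 1) → Subfield K)
    (hF : ∀ m : Fin n, F m.castSucc ≤ F m.succ) :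
    ∏ m : Fin n, relfinrank (F m.castSucc) (F m.succ) = relfinrank (F 0) (F (Fin.last n)) := by
  induction n with
  | zero => simp
  | succ n ih =>
    rw [Fin.prod_univ_castSucc]
    have h := ih (fun m => F m.castSucc) fun m => hF m.castSucc
    have hmono : Monotone F := Fin.monotone_iff_le_succ.2 hF
    rw [← Fin.succ_last,
      ← relfinrank_mul_relfinrank (hmono (Fin.zero_le (Fin.last n).castSucc)) (hF (Fin.last n))]
    exact congrArg (· * _) h

/-- If every step of a tower has degree at most `p` and the total degree is `p ^ n`, then every
step has degree exactly `p`. -/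
theorem Subfield.relfinrank_eq_of_le {p n : ℕ} (hp : 0 < p) (F : Fin (n + 1) → Subfield K)
    (hF : ∀ m : Fin n, F m.castSucc ≤ F m.succ)
    (hle : ∀ m : Fin n, relfinrank (F m.castSucc) (F m.succ) ≤ p)
    (htot : relfinrank (F 0) (F (Fin.last n)) = p ^ n) (m : Fin n) :
    relfinrank (F m.castSucc) (F m.succ) = p := by
  have hprod := (prod_relfinrank F hF).trans htot
  have hne : ∏ m : Fin n, relfinrank (F m.castSucc) (F m.succ) ≠ 0 := by
    rw [hprod]
    exact pow_ne_zero _ hp.ne'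
  refine (hle m).antisymm (not_lt.1 fun hlt => ?_)
  refine (Finset.prod_lt_prod (fun i _ => Nat.pos_of_ne_zero fun h0 => hne ?_)
    (fun i _ => hle i) ⟨m, Finset.mem_univ m, hlt⟩).ne (hprod.trans (by simp))
  exact Finset.prod_eq_zero (Finset.mem_univ i) h0

/-- The field of common constants of the derivations `δ j` with `m ≤ j`. -/
def constantsFrom {e : ℕ} (δ : Fin e → Derivation ℤ K K) (m : Fin (e + 1)) : Subfield K :=
  ⨅ j : {j : Fin e // (m : ℕ) ≤ j}, (δ j).constants

theorem mem_constantsFrom {e : ℕ} {δ : Fin e → Derivation ℤ K K} {m : Fin (e + 1)} {x : K} :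
    x ∈ constantsFrom δ m ↔ ∀ j : Fin e, (m : ℕ) ≤ j → δ j x = 0 := by
  simp [constantsFrom, Subfield.mem_iInf]

theorem constantsFrom_castSucc_le_succ {e : ℕ} (δ : Fin e → Derivation ℤ K K) (m : Fin e) :
    constantsFrom δ m.castSucc ≤ constantsFrom δ m.succ := fun x hx =>
  mem_constantsFrom.2 fun j hj => mem_constantsFrom.1 hx j (by simp at hj ⊢; omega)

theorem constantsFrom_last {e : ℕ} (δ : Fin e → Derivation ℤ K K) :
    constantsFrom δ (Fin.last e) = ⊤ :=
  eq_top_iff.2 fun x _ => mem_constantsFrom.2 fun j hj => absurd hj (by simp)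

theorem constantsFrom_castSucc {e : ℕ} {δ : Fin e → Derivation ℤ K K}
    (h : ∀ m n : Fin e, (n : ℕ) = m + 1 → ∀ x, δ m x = 0 → δ n x = 0) (m : Fin e) :
    constantsFrom δ m.castSucc = (δ m).constants := by
  ext x
  rw [mem_constantsFrom, Derivation.mem_constants]
  refine ⟨fun hx => hx m le_rfl, fun hx => ?_⟩
  suffices ∀ k, ∀ hk : m + k < e, δ ⟨m + k, hk⟩ x = 0 by
    intro j hj
    have hj' : (m : ℕ) ≤ j := hj
    have := this (j - m) (by omega)
    simpa only [Nat.add_sub_cancel' hj'] using this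
  intro k
  induction k with
  | zero => intro _; exact hx
  | succ k ih => intro hk; exact h ⟨m + k, by omega⟩ ⟨m + (k + 1), hk⟩ (by simp; omega) x (ih _)

theorem relfinrank_constantsFrom {p e : ℕ} (hp : 0 < p) {δ : Fin e → Derivation ℤ K K}
    (hsucc : ∀ m n : Fin e, (n : ℕ) = m + 1 → ∀ x, (δ m)^[p] x = 0 ↔ δ n x = 0)
    (hlast : ∀ m : Fin e, (m : ℕ) + 1 = e → ∀ x, (δ m)^[p] x = 0)
    (htot : Module.finrank (constantsFrom δ 0) K = p ^ e) (m : Fin e) :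
    Subfield.relfinrank (constantsFrom δ m.castSucc) (constantsFrom δ m.succ) = p := by
  refine Subfield.relfinrank_eq_of_le hp _ (constantsFrom_castSucc_le_succ δ) (fun m => ?_) ?_ m
  · have hC : constantsFrom δ m.castSucc = (δ m).constants := by
      refine constantsFrom_castSucc (fun m n hmn x hx => (hsucc m n hmn x).1 ?_) m
      obtain ⟨q, rfl⟩ := Nat.exists_eq_succ_of_ne_zero hp.ne'
      rw [Function.iterate_succ_apply, hx, iterate_map_zero]
    have hB := constantsFrom_castSucc_le_succ δ m
    have hmono : Monotone (constantsFrom δ) :=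
      Fin.monotone_iff_le_succ.2 (constantsFrom_castSucc_le_succ δ)
    have h0 := Subfield.relfinrank_mul_finrank_top (hmono (Fin.zero_le m.castSucc))
    rw [hC] at hB h0 ⊢
    have : FiniteDimensional (δ m).constants K := by
      refine Module.finite_of_finrank_pos (Nat.pos_of_ne_zero fun h => ?_)
      rw [h, mul_zero, htot] at h0
      exact pow_ne_zero _ hp.ne' h0.symm
    refine (δ m).relfinrank_constants_le hB fun x hx => ?_
    by_cases hm : (m : ℕ) + 1 = e
    · exact hlast m hm x
    · exact (hsucc m ⟨m + 1, by omega⟩ rfl x).2 (mem_constantsFrom.1 hx _ (by simp))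
  · rw [constantsFrom_last, Subfield.relfinrank_top_right, htot]

end Constants

section IsWeDCF

variable {p e : ℕ} [hp : Fact p.Prime] {K : Type*} [Field K] [CharP K p]
  {D : (Fin e → ℕ) → K → K}

theorem Finset.Iic_piSingle_one (m : Fin e) :
    Finset.Iic (Pi.single m 1 : Fin e → ℕ) = {0, Pi.single m 1} := by
  ext l
  simp only [Finset.mem_Iic, Finset.mem_insert, Finset.mem_singleton]
  constructor
  · intro h
    have h0 : ∀ j, j ≠ m → l j = 0 := fun j hj => by simpa [hj] using h j
    have h1 : l m ≤ 1 := by simpa using h m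
    rcases Nat.le_one_iff_eq_zero_or_eq_one.1 h1 with h1 | h1
    · left
      ext j
      by_cases hj : j = m
      · subst hj; simpa using h1
      · simp [h0 j hj]
    · right
      ext j
      by_cases hj : j = m
      · subst hj; simpa using h1
      · simp [h0 j hj, hj]
  · rintro (rfl | rfl)
    · exact fun _ => Nat.zero_le _
    · exact le_rfl

/-- The derivation `∂_m = D_{𝐞_m}`. -/
def IsWeDCF.derivation (hD : IsWeDCF p e K D) (m : Fin e) : Derivation ℤ K K :=
  Derivation.mk' (AddMonoidHom.mk' (D (Pi.single m 1)) (hD.2.2.2.1 _)).toIntLinearMap <| by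
    intro a b
    have hne : (0 : Fin e → ℕ) ≠ Pi.single m 1 := by
      intro h
      simpa using congrFun h m
    have h := hD.2.2.2.2.1 (Pi.single m 1) a b
    rw [Finset.Iic_piSingle_one, Finset.sum_pair hne] at h
    simp only [tsub_zero, tsub_self, hD.2.2.1, id] at h
    simpa [mul_comm] using h

theorem IsWeDCF.derivation_apply (hD : IsWeDCF p e K D) (m : Fin e) (x : K) :
    hD.derivation m x = D (Pi.single m 1) x := rfl

theorem IsWeDCF.apply_single_of_lt (hD : IsWeDCF p e K D) (m : Fin e) {k : ℕ} (hk : k + 1 < p)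
    (x : K) : D (Pi.single m 1) (D (Pi.single m k) x) =
      ((k + 1 : ℕ) : K) * D (Pi.single m (k + 1)) x := by
  rw [hD.2.2.2.2.2.1, finsum_eq_single _ (Pi.single m (k + 1)), wittAlpha_single_self,
    ZMod.cast_natCast']
  intro l hl
  have : wittAlpha p e (Pi.single m 1) (Pi.single m k) l = 0 := by
    rw [wittAlpha_single_single]
    by_contra h
    rcases eq_single_of_coeff_expXY_ne_zero p hk.le (fun h0 => h (by rw [h0, Int.cast_zero]))
      with h | ⟨h, -⟩
    · exact hl h
    · omega
  rw [this, ZMod.cast_zero, zero_mul]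

theorem wittAlpha_single_eq_zero {m : Fin e} {k : ℕ} (hk : k + 1 = p) {l : Fin e → ℕ}
    (hl : ∀ n : Fin e, (n : ℕ) = m + 1 → l ≠ Pi.single n 1) :
    wittAlpha p e (Pi.single m 1) (Pi.single m k) l = 0 := by
  by_cases hlk : l = Pi.single m (k + 1)
  · rw [hlk, wittAlpha_single_self, hk]
    simp
  · rw [wittAlpha_single_single]
    by_contra h
    rcases eq_single_of_coeff_expXY_ne_zero p hk.le (fun h0 => h (by rw [h0, Int.cast_zero]))
      with h | ⟨-, n, hn, h⟩
    · exact hlk h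
    · exact hl n hn h

theorem IsWeDCF.apply_single_of_eq (hD : IsWeDCF p e K D) {m n : Fin e} (hn : (n : ℕ) = m + 1)
    {k : ℕ} (hk : k + 1 = p) (x : K) :
    D (Pi.single m 1) (D (Pi.single m k) x) = -D (Pi.single n 1) x := by
  rw [hD.2.2.2.2.2.1, finsum_eq_single _ (Pi.single n 1), wittAlpha_single_succ p e hn hk]
  · have : (ZMod.cast (-1 : ZMod p) : K) = -1 := by
      rw [← ZMod.castHom_apply (h := dvd_refl p), map_neg, map_one]
    rw [this, neg_one_mul]
  · intro l hl
    rw [wittAlpha_single_eq_zero hk, ZMod.cast_zero, zero_mul]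
    intro n' hn' h
    obtain rfl : n' = n := Fin.ext (hn'.trans hn.symm)
    exact hl h

theorem IsWeDCF.apply_single_of_last (hD : IsWeDCF p e K D) {m : Fin e} (hm : (m : ℕ) + 1 = e)
    {k : ℕ} (hk : k + 1 = p) (x : K) :
    D (Pi.single m 1) (D (Pi.single m k) x) = 0 := by
  rw [hD.2.2.2.2.2.1, finsum_eq_zero_of_forall_eq_zero]
  intro l
  rw [wittAlpha_single_eq_zero hk, ZMod.cast_zero, zero_mul]
  intro n hn
  have := n.2
  omega

theorem IsWeDCF.derivation_iterate (hD : IsWeDCF p e K D) (m : Fin e) {k : ℕ} (hk : k < p)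
    (x : K) : (hD.derivation m)^[k] x = (k.factorial : K) * D (Pi.single m k) x := by
  induction k with
  | zero => simp [hD.2.2.1]
  | succ k ih =>
    rw [Function.iterate_succ_apply', ih (by omega), Derivation.leibniz, Derivation.map_natCast,
      smul_zero, add_zero, derivation_apply, hD.apply_single_of_lt m hk, Nat.factorial_succ]
    push_cast
    rw [smul_eq_mul]
    ring

theorem IsWeDCF.derivation_iterate_char (hD : IsWeDCF p e K D) (m : Fin e) {k : ℕ}
    (hk : k + 1 = p) (x : K) : (hD.derivation m)^[p] x =
      (k.factorial : K) * D (Pi.single m 1) (D (Pi.single m k) x) := by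
  subst hk
  rw [Function.iterate_succ_apply', hD.derivation_iterate m k.lt_succ_self, Derivation.leibniz,
    Derivation.map_natCast, smul_zero, add_zero, derivation_apply, smul_eq_mul]

theorem IsWeDCF.derivation_iterate_char_eq_zero_iff (hD : IsWeDCF p e K D) {m n : Fin e}
    (hn : (n : ℕ) = m + 1) (x : K) : (hD.derivation m)^[p] x = 0 ↔ hD.derivation n x = 0 := by
  obtain ⟨k, hk⟩ := Nat.exists_eq_succ_of_ne_zero hp.out.ne_zero
  have hfac : (k.factorial : K) ≠ 0 := by
    rw [Ne, CharP.cast_eq_zero_iff K p, hp.out.dvd_factorial]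
    omega
  rw [hD.derivation_iterate_char m hk.symm, hD.apply_single_of_eq hn hk.symm, mul_eq_zero,
    or_iff_right hfac, neg_eq_zero, derivation_apply]

theorem IsWeDCF.derivation_iterate_char_of_last (hD : IsWeDCF p e K D) {m : Fin e}
    (hm : (m : ℕ) + 1 = e) (x : K) : (hD.derivation m)^[p] x = 0 := by
  obtain ⟨k, hk⟩ := Nat.exists_eq_succ_of_ne_zero hp.out.ne_zero
  rw [hD.derivation_iterate_char m hk.symm, hD.apply_single_of_last hm hk.symm, mul_zero]

theorem IsWeDCF.constantsFrom_zero (hD : IsWeDCF p e K D) :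
    constantsFrom hD.derivation 0 = RingHom.fieldRange (frobenius K p) := by
  ext x
  rw [mem_constantsFrom, RingHom.mem_fieldRange]
  simp only [Fin.val_zero, Nat.zero_le, true_imp_iff, derivation_apply, frobenius_def]
  rw [hD.2.2.2.2.2.2 x]
  simp only [eq_comm]

end IsWeDCF

/-- In a model of `W_e`-DCF, writing `∂_m := D_{𝐞_m}`, the sets
`F_m := ⋂_{j=m}^{e} ker ∂_j` (with `F_{e+1} := K`) are subfields of `K`
(`0`-indexed: `F m` corresponds to the kernel intersection over all `j ≥ m`) and each
extension `F_{m+1}/F_m` has degree `p`. -/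
theorem WeDCF_kernel_tower (p e : ℕ) [Fact p.Prime] (he : 1 ≤ e)
    (K : Type*) [Field K] [CharP K p] (D : (Fin e → ℕ) → K → K)
    (hD : IsWeDCF p e K D) :
    ∃ F : Fin (e + 1) → Subfield K,
      (∀ m : Fin (e + 1), (F m : Set K) =
        {x : K | ∀ j : Fin e, (m : ℕ) ≤ (j : ℕ) → D (Pi.single j 1) x = 0}) ∧
      (∀ m : Fin e, F m.castSucc ≤ F m.succ ∧
        Subfield.relfinrank (F m.castSucc) (F m.succ) = p) := by
  refine ⟨constantsFrom hD.derivation, fun m => Set.ext fun x => mem_constantsFrom, fun m =>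
    ⟨constantsFrom_castSucc_le_succ _ m, relfinrank_constantsFrom (Fact.out : p.Prime).pos
      (fun _ _ hn => hD.derivation_iterate_char_eq_zero_iff hn)
      (fun _ hm => hD.derivation_iterate_char_of_last hm) ?_ m⟩⟩
  rw [hD.constantsFrom_zero]
  exact hD.2.1
end
end
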